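/- arXiv:2212.01521 — 2 statements merged into one kernel-verified Lean document; each statement's English description precedes it below -/
import Mathlib

section
/- Let m be a σ-finite measure on a measurable space Ω, and let p, q : Ω → ℝ be measurable functions with 0 ≤ p x and 0 ≤ q x for all x, ∫ p dm = 1 and ∫ q dm = 1. Assume the functions x ↦ p x · log(p x / (p x + q x)) and x ↦ q x · log(q x / (p x + q x)) are integrable with respect to m. Then ∫ p x · log(p x / (p x + q x)) dm + ∫ q x · log(q x / (p x + q x)) dm ≥ −log 4, and equality holds if and only if p = q m-almost everywhere. -/
open MeasureTheory

/-- Tangent-line bound for `a * log (a / (a + b))` at `a = b`, strict away from the diagonal. -/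
theorem half_sub_lt_mul_log_div_add {a b : ℝ} (ha : 0 ≤ a) (hb : 0 ≤ b) (hab : a ≠ b) :
    (a - b) / 2 < a * Real.log (a / (a + b)) + a * Real.log 2 := by
  rcases ha.eq_or_lt with rfl | ha
  · have : 0 < b := lt_of_le_of_ne hb hab
    rw [zero_mul, zero_mul]
    linarith
  · have hs : 0 < a + b := by positivity
    have hne : (a + b) / (2 * a) ≠ 1 := by
      intro h
      rw [div_eq_one_iff_eq (by positivity)] at h
      exact hab (by linarith)
    have hlog := Real.log_lt_sub_one_of_pos (by positivity) hne
    rw [Real.log_div hs.ne' (by positivity), Real.log_mul two_ne_zero ha.ne'] at hlog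
    rw [Real.log_div ha.ne' hs.ne']
    have hmul := mul_lt_mul_of_pos_left hlog ha
    have hcancel : a * ((a + b) / (2 * a) - 1) = (b - a) / 2 := by
      field_simp
      ring
    linarith

theorem mul_log_div_self_add_self (a : ℝ) :
    a * Real.log (a / (a + a)) + a * Real.log 2 = 0 := by
  rcases eq_or_ne a 0 with rfl | ha
  · simp
  · rw [← two_mul, Real.log_div ha (by positivity), Real.log_mul two_ne_zero ha]
    ring

/-- Pointwise excess of the optimal-discriminator criterion over its value at equal densities. -/
noncomputable def criterionExcess (a b : ℝ) : ℝ :=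
  (a * Real.log (a / (a + b)) + b * Real.log (b / (a + b))) + (a + b) * Real.log 2

theorem criterionExcess_self (a : ℝ) : criterionExcess a a = 0 := by
  have := mul_log_div_self_add_self a
  unfold criterionExcess
  linarith

theorem criterionExcess_pos {a b : ℝ} (ha : 0 ≤ a) (hb : 0 ≤ b) (hab : a ≠ b) :
    0 < criterionExcess a b := by
  have h₁ := half_sub_lt_mul_log_div_add ha hb hab
  have h₂ := half_sub_lt_mul_log_div_add hb ha hab.symm
  rw [add_comm b a] at h₂
  unfold criterionExcess
  linarith

theorem criterionExcess_nonneg {a b : ℝ} (ha : 0 ≤ a) (hb : 0 ≤ b) :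
    0 ≤ criterionExcess a b := by
  rcases eq_or_ne a b with rfl | hab
  · exact (criterionExcess_self a).ge
  · exact (criterionExcess_pos ha hb hab).le

theorem criterionExcess_eq_zero_iff {a b : ℝ} (ha : 0 ≤ a) (hb : 0 ≤ b) :
    criterionExcess a b = 0 ↔ a = b := by
  refine ⟨fun h => ?_, fun h => h ▸ criterionExcess_self a⟩
  by_contra hab
  exact (criterionExcess_pos ha hb hab).ne' h

/-- The GAN virtual training criterion at the optimal discriminator,
`∫ p log(p/(p+q)) + ∫ q log(q/(p+q))`, is at least `-log 4`, with equality
if and only if the two densities `p` and `q` agree `m`-almost everywhere. -/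
theorem gan_criterion_min {Ω : Type*} [MeasurableSpace Ω] (m : Measure Ω) [SigmaFinite m]
    (p q : Ω → ℝ) (hpm : Measurable p) (hqm : Measurable q)
    (hp0 : ∀ x, 0 ≤ p x) (hq0 : ∀ x, 0 ≤ q x)
    (hpi : ∫ x, p x ∂m = 1) (hqi : ∫ x, q x ∂m = 1)
    (h1 : Integrable (fun x => p x * Real.log (p x / (p x + q x))) m)
    (h2 : Integrable (fun x => q x * Real.log (q x / (p x + q x))) m) :
    (-Real.log 4 ≤
      (∫ x, p x * Real.log (p x / (p x + q x)) ∂m) +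
      (∫ x, q x * Real.log (q x / (p x + q x)) ∂m)) ∧
    ((∫ x, p x * Real.log (p x / (p x + q x)) ∂m) +
      (∫ x, q x * Real.log (q x / (p x + q x)) ∂m) = -Real.log 4 ↔ p =ᵐ[m] q) := by
  have hp : Integrable p m := .of_integral_ne_zero (by simp [hpi])
  have hq : Integrable q m := .of_integral_ne_zero (by simp [hqi])
  have hlog : Real.log 4 = 2 * Real.log 2 := by
    rw [show (4 : ℝ) = 2 ^ 2 by norm_num, Real.log_pow]
    norm_num
  have hcrit : Integrable (fun x => p x * Real.log (p x / (p x + q x)) +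
      q x * Real.log (q x / (p x + q x))) m := h1.add h2
  have hmass : Integrable (fun x => (p x + q x) * Real.log 2) m := (hp.add hq).mul_const _
  have hint : Integrable (fun x => criterionExcess (p x) (q x)) m := hcrit.add hmass
  have hnonneg : 0 ≤ fun x => criterionExcess (p x) (q x) :=
    fun x => criterionExcess_nonneg (hp0 x) (hq0 x)
  have hval : ∫ x, criterionExcess (p x) (q x) ∂m =
      ((∫ x, p x * Real.log (p x / (p x + q x)) ∂m) +
        ∫ x, q x * Real.log (q x / (p x + q x)) ∂m) + Real.log 4 := by
    unfold criterionExcess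
    rw [integral_add hcrit hmass, integral_add h1 h2,
      integral_mul_const, integral_add hp hq, hpi, hqi, hlog]
    norm_num
  constructor
  · have := integral_nonneg (μ := m) hnonneg
    linarith
  · rw [eq_neg_iff_add_eq_zero, ← hval, integral_eq_zero_iff_of_nonneg hnonneg hint]
    exact Filter.eventually_congr <| .of_forall fun x =>
      criterionExcess_eq_zero_iff (hp0 x) (hq0 x)
end

section
/- Let p, q : ℝ → ℝ be measurable functions with 0 ≤ p x and 0 ≤ q x for all x, and with ∫ p(x) dx = 1 and ∫ q(x) dx = 1 (with respect to Lebesgue measure). Assume that the functions x ↦ p x · log(p x / (p x + q x)), x ↦ q x · log(q x / (p x + q x)), x ↦ x·p x, x ↦ x·q x, x ↦ x²·p x, and x ↦ x²·q x are all Lebesgue integrable. Define C = ∫ p x · log(p x / (p x + q x)) dx + ∫ q x · log(q x / (p x + q x)) dx, the means μ_p = ∫ x·p x dx and μ_q = ∫ x·q x dx, the standard deviations σ_p = √(∫ x²·p x dx − μ_p²) and σ_q = √(∫ x²·q x dx − μ_q²), and the penalty L = |μ_q − μ_p| + |σ_q − σ_p|. Then for every λ ≥ 0: C + λ·L = −log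 4 if and only if p = q Lebesgue-almost everywhere; moreover C + λ·L ≥ −log 4. -/
open MeasureTheory

theorem sub_half_add_le_mul_log {a b : ℝ} (ha : 0 ≤ a) (hb : 0 ≤ b) :
    a - (a + b) / 2 ≤ a * Real.log (a / (a + b)) + a * Real.log 2 := by
  rcases ha.eq_or_lt with rfl | ha
  · simp
    linarith
  · have hs : 0 < a + b := by linarith
    have h := Real.one_sub_inv_le_log_of_pos (x := a / (a + b) * 2) (by positivity)
    rw [Real.log_mul (by positivity) (by norm_num)] at h
    have h' := mul_le_mul_of_nonneg_left h ha.le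
    have e : a * (1 - (a / (a + b) * 2)⁻¹) = a - (a + b) / 2 := by
      field_simp
    linarith

theorem eq_of_mul_log_eq_sub_half_add {a b : ℝ} (ha : 0 ≤ a) (hb : 0 ≤ b)
    (h : a * Real.log (a / (a + b)) + a * Real.log 2 = a - (a + b) / 2) : a = b := by
  rcases ha.eq_or_lt with rfl | ha
  · simp at h
    linarith
  · have hs : 0 < a + b := by linarith
    by_contra hne
    have h1 : (a + b) / (2 * a) ≠ 1 := by
      intro h1
      rw [div_eq_one_iff_eq (by positivity)] at h1
      exact hne (by linarith)
    have h2 := Real.log_lt_sub_one_of_pos (by positivity) h1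
    rw [Real.log_div hs.ne' (by positivity), Real.log_mul (by norm_num) ha.ne'] at h2
    rw [Real.log_div ha.ne' hs.ne'] at h
    have h3 := mul_lt_mul_of_pos_left h2 ha
    have e : a * ((a + b) / (2 * a) - 1) = (a + b) / 2 - a := by
      field_simp
    linarith

/-- Pointwise deficit of the optimal-discriminator integrand from its minimum. -/
noncomputable def ganDeficit (a b : ℝ) : ℝ :=
  a * Real.log (a / (a + b)) + b * Real.log (b / (a + b)) + (a + b) * Real.log 2

theorem ganDeficit_nonneg {a b : ℝ} (ha : 0 ≤ a) (hb : 0 ≤ b) : 0 ≤ ganDeficit a b := by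
  have h1 := sub_half_add_le_mul_log ha hb
  have h2 := sub_half_add_le_mul_log hb ha
  rw [add_comm b a] at h2
  unfold ganDeficit
  linarith

theorem ganDeficit_self (a : ℝ) : ganDeficit a a = 0 := by
  rcases eq_or_ne a 0 with rfl | ha
  · simp [ganDeficit]
  · have e : a / (a + a) = 2⁻¹ := by
      field_simp
      norm_num
    rw [ganDeficit, e, Real.log_inv]
    ring

theorem ganDeficit_eq_zero_iff {a b : ℝ} (ha : 0 ≤ a) (hb : 0 ≤ b) :
    ganDeficit a b = 0 ↔ a = b := by
  refine ⟨fun h => eq_of_mul_log_eq_sub_half_add ha hb ?_, fun h => h ▸ ganDeficit_self a⟩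
  have h1 := sub_half_add_le_mul_log ha hb
  have h2 := sub_half_add_le_mul_log hb ha
  rw [add_comm b a] at h2
  unfold ganDeficit at h
  linarith

/-- One-dimensional form of Theorem 4.1 of the paper: for densities `p`, `q` on
`ℝ`, the penalized GAN objective `C + λ·L`, where `C` is the virtual training
criterion at the optimal discriminator and `L` is the GDF penalty matching the
mean and standard deviation, is at least `-log 4`, with equality if and only if
`p = q` Lebesgue-almost everywhere. -/
theorem gdf_penalized_min (p q : ℝ → ℝ) (hpm : Measurable p) (hqm : Measurable q)
    (hp0 : ∀ x, 0 ≤ p x) (hq0 : ∀ x, 0 ≤ q x)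
    (hpi : ∫ x, p x = 1) (hqi : ∫ x, q x = 1)
    (h1 : Integrable (fun x => p x * Real.log (p x / (p x + q x))))
    (h2 : Integrable (fun x => q x * Real.log (q x / (p x + q x))))
    (h3 : Integrable (fun x => x * p x)) (h4 : Integrable (fun x => x * q x))
    (h5 : Integrable (fun x => x ^ 2 * p x)) (h6 : Integrable (fun x => x ^ 2 * q x))
    (C μp μq σp σq L : ℝ)
    (hC : C = (∫ x, p x * Real.log (p x / (p x + q x))) +
      (∫ x, q x * Real.log (q x / (p x + q x))))
    (hμp : μp = ∫ x, x * p x) (hμq : μq = ∫ x, x * q x)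
    (hσp : σp = Real.sqrt ((∫ x, x ^ 2 * p x) - μp ^ 2))
    (hσq : σq = Real.sqrt ((∫ x, x ^ 2 * q x) - μq ^ 2))
    (hL : L = |μq - μp| + |σq - σp|)
    (lam : ℝ) (hlam : 0 ≤ lam) :
    (C + lam * L = -Real.log 4 ↔ p =ᵐ[volume] q) ∧ -Real.log 4 ≤ C + lam * L := by
  have hp : Integrable p := .of_integral_ne_zero (by simp [hpi])
  have hq : Integrable q := .of_integral_ne_zero (by simp [hqi])
  have hpq : Integrable (fun x => (p x + q x) * Real.log 2) := (hp.add hq).mul_const _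
  have h12 : Integrable (fun x => p x * Real.log (p x / (p x + q x)) +
      q x * Real.log (q x / (p x + q x))) := h1.add h2
  have hk : Integrable (fun x => ganDeficit (p x) (q x)) := h12.add hpq
  have hk0 : ∀ x, 0 ≤ ganDeficit (p x) (q x) := fun x => ganDeficit_nonneg (hp0 x) (hq0 x)
  have hlog : Real.log 4 = 2 * Real.log 2 := by
    rw [show (4 : ℝ) = 2 ^ 2 by norm_num, Real.log_pow]
    norm_num
  have hint : ∫ x, ganDeficit (p x) (q x) = C + Real.log 4 := by
    unfold ganDeficit
    rw [integral_add h12 hpq, integral_add h1 h2, integral_mul_const, integral_add hp hq,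
      hpi, hqi, hC, hlog]
    ring
  have hint0 : 0 ≤ ∫ x, ganDeficit (p x) (q x) := integral_nonneg hk0
  have hzero : ∫ x, ganDeficit (p x) (q x) = 0 ↔ p =ᵐ[volume] q := by
    rw [integral_eq_zero_iff_of_nonneg hk0 hk]
    exact Filter.eventually_congr
      (.of_forall fun x => ganDeficit_eq_zero_iff (hp0 x) (hq0 x))
  have hlamL : 0 ≤ lam * L := mul_nonneg hlam (hL ▸ by positivity)
  refine ⟨⟨fun h => hzero.1 (by linarith), fun h => ?_⟩, by linarith⟩
  have hμ : μp = μq := by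
    rw [hμp, hμq]
    exact integral_congr_ae (h.mono fun x hx => by simp only [hx])
  have hσ : σp = σq := by
    have h2 : ∫ x, x ^ 2 * p x = ∫ x, x ^ 2 * q x :=
      integral_congr_ae (h.mono fun x hx => by simp only [hx])
    rw [hσp, hσq, hμ, h2]
  have hL0 : L = 0 := by simp [hL, hμ, hσ]
  have := hzero.2 h
  rw [hL0]
  linarith
end
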